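/- Global simulation theorem: for every statement c, state s, syntactic configuration cf' and state s', if the small-step semantics reaches ((Loc c PTop, True), s) →* (cf', s') (reflexive-transitive closure), then the generated automaton reaches the same state: stmt_to_ta c ⊢ (init_s (stmt_to_ta c), s) →* (cf', s') (reflexive-transitive closure of the automaton transition relation), where the correspondence ≈ between semantic configurations and automaton states is plain equality. -/

import Mathlib

/-! Language: values, expressions, statements, zipper paths -/

abbrev vname := String

inductive val where
  | Bool : Bool → val
  | Null : val
deriving DecidableEq

inductive expr where
  | Val : val → expr
  | Var : vname → expr
deriving DecidableEq

inductive stmt where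
  | Empty : stmt
  | Assign : vname → val → stmt
  | Seq : stmt → stmt → stmt
  | Cond : expr → stmt → stmt → stmt
  | While : expr → stmt → stmt
deriving DecidableEq

inductive stmt_path where
  | PTop : stmt_path
  | PSeqLeft : stmt_path → stmt → stmt_path
  | PSeqRight : stmt → stmt_path → stmt_path
  | PCondLeft : expr → stmt_path → stmt → stmt_path
  | PCondRight : expr → stmt → stmt_path → stmt_path
  | PWhile : expr → stmt_path → stmt_path
deriving DecidableEq

inductive stmt_location where
  | Loc : stmt → stmt_path → stmt_location
deriving DecidableEq

abbrev synt_config := stmt_location × Bool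

abbrev state := vname → Option val

def eval : expr → state → val
  | expr.Val v, _ => v
  | expr.Var x, s => (s x).getD val.Null

open stmt stmt_path stmt_location

def next_loc : stmt → stmt_path → stmt_location × Bool
  | c, PTop => (Loc c PTop, false)
  | c, PSeqLeft sp c2 => (Loc c2 (PSeqRight c sp), true)
  | c, PSeqRight c1 sp => (Loc (Seq c1 c) sp, false)
  | c, PCondLeft e sp c2 => (Loc (Cond e c c2) sp, false)
  | c, PCondRight e c1 sp => (Loc (Cond e c1 c) sp, false)
  | c, PWhile e sp => (Loc (While e c) sp, true)

/-- Small-step operational semantics on semantic configurations. -/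
inductive smallStep : synt_config × state → synt_config × state → Prop where
  | SEmpty (sp : stmt_path) (s : state) :
      smallStep ((Loc Empty sp, true), s) ((Loc Empty sp, false), s)
  | SAssign (vr : vname) (vl : val) (sp : stmt_path) (s : state) :
      smallStep ((Loc (Assign vr vl) sp, true), s)
                ((Loc (Assign vr vl) sp, false), Function.update s vr (some vl))
  | SSeq (c1 c2 : stmt) (sp : stmt_path) (s : state) :
      smallStep ((Loc (Seq c1 c2) sp, true), s) ((Loc c1 (PSeqLeft sp c2), true), s)
  | SCondT (e : expr) (c1 c2 : stmt) (sp : stmt_path) (s : state) :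
      eval e s = val.Bool true →
      smallStep ((Loc (Cond e c1 c2) sp, true), s) ((Loc c1 (PCondLeft e sp c2), true), s)
  | SCondF (e : expr) (c1 c2 : stmt) (sp : stmt_path) (s : state) :
      eval e s = val.Bool false →
      smallStep ((Loc (Cond e c1 c2) sp, true), s) ((Loc c2 (PCondRight e c1 sp), true), s)
  | SWhileT (e : expr) (c : stmt) (sp : stmt_path) (s : state) :
      eval e s = val.Bool true →
      smallStep ((Loc (While e c) sp, true), s) ((Loc c (PWhile e sp), true), s)
  | SWhileF (e : expr) (c : stmt) (sp : stmt_path) (s : state) :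
      eval e s = val.Bool false →
      smallStep ((Loc (While e c) sp, true), s) ((Loc (While e c) sp, false), s)
  | SFalse (c : stmt) (sp : stmt_path) (s : state) :
      sp ≠ PTop →
      smallStep ((Loc c sp, false), s) (next_loc c sp, s)

/-! Automata -/

inductive action where
  | NoAct : action
  | AssAct : vname → val → action
deriving DecidableEq

structure edge (n : Type) where
  source : n
  action : action
  dest : n
deriving DecidableEq

structure ta (n : Type) where
  nodes : List n
  edges : List (edge n)
  init_s : n

def action_effect : action → state → state
  | action.NoAct, s => s
  | action.AssAct x v, s => Function.update s x (some v)

/-- Automaton transition semantics. -/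
def ta_step {n : Type} (aut : ta n) (p q : n × state) : Prop :=
  ∃ e ∈ aut.edges, e.source = p.1 ∧ e.dest = q.1 ∧ q.2 = action_effect e.action p.2

def synt_step_image : synt_config → List synt_config
  | (Loc stmt.Empty sp, true) => [(Loc stmt.Empty sp, false)]
  | (Loc (stmt.Assign vr vl) sp, true) => [(Loc (stmt.Assign vr vl) sp, false)]
  | (Loc (stmt.Seq c1 c2) sp, true) => [(Loc c1 (PSeqLeft sp c2), true)]
  | (Loc (stmt.Cond e c1 c2) sp, true) =>
      [(Loc c1 (PCondLeft e sp c2), true), (Loc c2 (PCondRight e c1 sp), true)]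
  | (Loc (stmt.While e c) sp, true) =>
      [(Loc c (PWhile e sp), true), (Loc (stmt.While e c) sp, false)]
  | (Loc c sp, false) => if sp = PTop then [] else [next_loc c sp]

def action_of_synt_config : synt_config → action
  | (Loc (stmt.Assign vn vl) _, true) => action.AssAct vn vl
  | _ => action.NoAct

def synt_step_image_closed (aut : ta synt_config) : Prop :=
  ∀ n ∈ aut.nodes, ∀ t ∈ synt_step_image n,
    t ∈ aut.nodes ∧
    (⟨n, action_of_synt_config n, t⟩ : edge synt_config) ∈ aut.edges

def all_locations : stmt → stmt_path → List stmt_location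
  | stmt.Empty, sp => [Loc stmt.Empty sp]
  | stmt.Assign vr vl, sp => [Loc (stmt.Assign vr vl) sp]
  | stmt.Seq c1 c2, sp =>
      Loc (stmt.Seq c1 c2) sp ::
        (all_locations c1 (PSeqLeft sp c2) ++ all_locations c2 (PSeqRight c1 sp))
  | stmt.Cond e c1 c2, sp =>
      Loc (stmt.Cond e c1 c2) sp ::
        (all_locations c1 (PCondLeft e sp c2) ++ all_locations c2 (PCondRight e c1 sp))
  | stmt.While e c, sp => Loc (stmt.While e c) sp :: all_locations c (PWhile e sp)

def nodes_of_stmt_locations (ls : List stmt_location) : List synt_config :=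
  ls.flatMap (fun l => [(l, true), (l, false)])

def edge_of_synt_config (s : synt_config) : List (edge synt_config) :=
  (synt_step_image s).map (fun t => ⟨s, action_of_synt_config s, t⟩)

def edges_of_nodes (nds : List synt_config) : List (edge synt_config) :=
  nds.flatMap edge_of_synt_config

def stmt_to_ta (c : stmt) : ta synt_config :=
  let nds := nodes_of_stmt_locations (all_locations c PTop)
  ⟨nds, edges_of_nodes nds, (Loc c PTop, true)⟩

theorem self_mem_all_locations (c : stmt) (sp : stmt_path) : Loc c sp ∈ all_locations c sp := by
  cases c <;> simp [all_locations]

theorem mem_all_locations_trans {c d e : stmt} {p q r : stmt_path}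
    (hd : Loc d q ∈ all_locations c p) (he : Loc e r ∈ all_locations d q) :
    Loc e r ∈ all_locations c p := by
  induction c generalizing p with
  | Empty | Assign =>
    simp only [all_locations, List.mem_singleton, Loc.injEq] at hd
    obtain ⟨rfl, rfl⟩ := hd
    exact he
  | Seq c1 c2 ih1 ih2 | Cond b c1 c2 ih1 ih2 =>
    simp only [all_locations, List.mem_cons, List.mem_append, Loc.injEq] at hd
    obtain ⟨rfl, rfl⟩ | h | h := hd
    · exact he
    · simp [all_locations, ih1 h]
    · simp [all_locations, ih2 h]
  | While b c ih =>
    simp only [all_locations, List.mem_cons, Loc.injEq] at hd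
    obtain ⟨rfl, rfl⟩ | h := hd
    · exact he
    · simp [all_locations, ih h]

theorem eq_or_next_loc_mem_all_locations {c d : stmt} {p q : stmt_path}
    (hd : Loc d q ∈ all_locations c p) :
    Loc d q = Loc c p ∨ (next_loc d q).1 ∈ all_locations c p := by
  induction c generalizing p with
  | Empty | Assign => exact Or.inl (by simpa [all_locations] using hd)
  | Seq c1 c2 ih1 ih2 | Cond b c1 c2 ih1 ih2 =>
    simp only [all_locations, List.mem_cons, List.mem_append] at hd ⊢
    obtain h | h | h := hd
    · exact Or.inl h
    · obtain h | h := ih1 h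
      · obtain ⟨rfl, rfl⟩ := Loc.inj h
        simp [next_loc, self_mem_all_locations]
      · simp [h]
    · obtain h | h := ih2 h
      · obtain ⟨rfl, rfl⟩ := Loc.inj h
        simp [next_loc]
      · simp [h]
  | While b c ih =>
    simp only [all_locations, List.mem_cons] at hd ⊢
    obtain h | h := hd
    · exact Or.inl h
    · obtain h | h := ih h
      · obtain ⟨rfl, rfl⟩ := Loc.inj h
        simp [next_loc]
      · simp [h]

theorem mem_nodes_of_stmt_locations {ls : List stmt_location} {n : synt_config} :
    n ∈ nodes_of_stmt_locations ls ↔ n.1 ∈ ls := by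
  obtain ⟨l, b⟩ := n
  cases b <;> simp [nodes_of_stmt_locations]

theorem synt_step_image_mem_all_locations {c : stmt} {n t : synt_config}
    (hn : n.1 ∈ all_locations c PTop) (ht : t ∈ synt_step_image n) :
    t.1 ∈ all_locations c PTop := by
  obtain ⟨⟨d, q⟩, b⟩ := n
  cases b with
  | false =>
    by_cases hq : q = PTop
    · simp [synt_step_image, hq] at ht
    · obtain rfl : t = next_loc d q := by simpa [synt_step_image, hq] using ht
      exact (eq_or_next_loc_mem_all_locations hn).resolve_left fun h => hq (Loc.inj h).2
  | true =>
    cases d <;> simp only [synt_step_image, List.mem_cons, List.not_mem_nil, or_false] at ht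
    case Empty | Assign | Seq =>
      subst ht
      exact mem_all_locations_trans hn (by simp [all_locations, self_mem_all_locations])
    case Cond | While =>
      obtain rfl | rfl := ht <;>
        exact mem_all_locations_trans hn (by simp [all_locations, self_mem_all_locations])

theorem synt_step_image_closed_stmt_to_ta (c : stmt) :
    synt_step_image_closed (stmt_to_ta c) := by
  intro n hn t ht
  refine ⟨mem_nodes_of_stmt_locations.2
    (synt_step_image_mem_all_locations (mem_nodes_of_stmt_locations.1 hn) ht), ?_⟩
  exact List.mem_flatMap.2 ⟨n, hn, List.mem_map.2 ⟨t, ht, rfl⟩⟩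

theorem smallStep.mem_synt_step_image {x y : synt_config × state} (h : smallStep x y) :
    y.1 ∈ synt_step_image x.1 ∧ y.2 = action_effect (action_of_synt_config x.1) x.2 := by
  cases h <;> simp_all [synt_step_image, action_of_synt_config, action_effect]

theorem smallStep.ta_step {aut : ta synt_config} (haut : synt_step_image_closed aut)
    {x y : synt_config × state} (hx : x.1 ∈ aut.nodes) (h : smallStep x y) :
    ta_step aut x y ∧ y.1 ∈ aut.nodes := by
  obtain ⟨himg, hst⟩ := h.mem_synt_step_image
  obtain ⟨hy, he⟩ := haut _ hx _ himg
  exact ⟨⟨_, he, rfl, rfl, hst⟩, hy⟩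

theorem ta_steps_of_smallSteps {aut : ta synt_config} (haut : synt_step_image_closed aut)
    {x y : synt_config × state} (hx : x.1 ∈ aut.nodes)
    (h : Relation.ReflTransGen smallStep x y) :
    Relation.ReflTransGen (ta_step aut) x y ∧ y.1 ∈ aut.nodes := by
  induction h with
  | refl => exact ⟨.refl, hx⟩
  | tail _ hstep ih =>
    obtain ⟨hrun, hnode⟩ := ih
    obtain ⟨ht, hy⟩ := hstep.ta_step haut hnode
    exact ⟨hrun.tail ht, hy⟩

/-- Global simulation theorem: whenever a state is reachable by
executing a program `c` from its initial configuration, the same state is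
reachable by running the automaton `stmt_to_ta c` from its initial node. -/
theorem simulation_generated
    (c : stmt) (s : state) (cf' : synt_config) (s' : state)
    (h : Relation.ReflTransGen smallStep ((Loc c PTop, true), s) (cf', s')) :
    Relation.ReflTransGen (ta_step (stmt_to_ta c)) ((stmt_to_ta c).init_s, s) (cf', s') := by
  exact (ta_steps_of_smallSteps (synt_step_image_closed_stmt_to_ta c)
    (mem_nodes_of_stmt_locations.2 (self_mem_all_locations c PTop)) h).1
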